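/- Let u₀,u₁ be an orthonormal basis of ℂ², let 0 < ρ < 1 and θ ∈ ℝ. Define a⁰,a¹ : ℕ → ℂ² by a⁰₀ := ρ·u₀, a⁰_k := (1−ρ²)·e^{iθ}·(−ρe^{iθ})^{k−1}·u₀ for k ≥ 1, a¹₀ := u₁, a¹_k := 0 for k ≥ 1 (the Type 4 family). Then a⁰,a¹ satisfy condition (A) and conditions (C1)–(C5). -/

import Mathlib

open Finset

/-- `ℂ²` with its Euclidean structure. -/
abbrev E2 := EuclideanSpace ℂ (Fin 2)

/-- The inner product of `ℂ²`: `⟨u,v⟩ = u⁽¹⁾conj(v⁽¹⁾) + u⁽²⁾conj(v⁽²⁾)`. -/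
noncomputable def cinner (u v : E2) : ℂ := ∑ i, u i * (starRingEnd ℂ) (v i)

/-- Condition (A). -/
def condA (a0 a1 : ℕ → E2) : Prop :=
  (∀ m : ℕ, (∑' k : ℕ, cinner (a0 (k + m)) (a0 k)) = if m = 0 then 1 else 0) ∧
  (∀ m : ℕ, (∑' k : ℕ, cinner (a1 (k + m)) (a1 k)) = if m = 0 then 1 else 0) ∧
  (∀ m : ℕ, (∑' k : ℕ, cinner (a0 (k + m)) (a1 k)) = 0) ∧
  (∀ m : ℕ, (∑' k : ℕ, cinner (a1 (k + m)) (a0 k)) = 0)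

/-- Conditions (C1)–(C5), with `d := 1 − ‖a0 0‖²`. -/
def condC (a0 a1 : ℕ → E2) : Prop :=
  (∀ p : ℕ, 1 ≤ p → ‖cinner (a0 p) (a0 0)‖ ^ 2
      = (1 - ‖a0 0‖ ^ 2) * (1 - ∑ k ∈ Finset.range (p + 1), ‖a0 k‖ ^ 2)) ∧
  (∀ p : ℕ, ‖cinner (a1 p) (a0 0)‖ ^ 2
      = (1 - ‖a0 0‖ ^ 2) * (1 - ∑ k ∈ Finset.range (p + 1), ‖a1 k‖ ^ 2)) ∧
  (∀ p p' : ℕ, 0 < p → p < p' →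
    cinner (a0 p') (a0 0) * cinner (a0 0) (a0 p)
      = -((1 - ‖a0 0‖ ^ 2 : ℝ) : ℂ) *
          ∑ r ∈ Finset.range (p + 1), cinner (a0 (p' - r)) (a0 (p - r))) ∧
  (∀ p p' : ℕ, p < p' →
    cinner (a1 p') (a0 0) * cinner (a0 0) (a1 p)
      = -((1 - ‖a0 0‖ ^ 2 : ℝ) : ℂ) *
          ∑ r ∈ Finset.range (p + 1), cinner (a1 (p' - r)) (a1 (p - r))) ∧
  (∀ p p' : ℕ, 0 < p → p ≤ p' →
    cinner (a1 p') (a0 0) * cinner (a0 0) (a0 p)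
      = -((1 - ‖a0 0‖ ^ 2 : ℝ) : ℂ) *
          ∑ r ∈ Finset.range (p + 1), cinner (a1 (p' - r)) (a0 (p - r))) ∧
  (∀ p p' : ℕ, p' < p →
    cinner (a1 p') (a0 0) * cinner (a0 0) (a0 p)
      = -((1 - ‖a0 0‖ ^ 2 : ℝ) : ℂ) *
          ∑ r ∈ Finset.range (p' + 1), cinner (a1 (p' - r)) (a0 (p - r)))

open ComplexConjugate

lemma cinner_smul_smul (x y : ℂ) (u v : E2) :
    cinner (x • u) (y • v) = x * conj y * cinner u v := by
  simp only [cinner, PiLp.smul_apply, smul_eq_mul, map_mul, Finset.mul_sum]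
  exact Finset.sum_congr rfl fun i _ => by ring

lemma cinner_self (u : E2) : cinner u u = (‖u‖ : ℂ) ^ 2 := by
  rw [← Complex.ofReal_pow, EuclideanSpace.norm_sq_eq, Complex.ofReal_sum]
  exact Finset.sum_congr rfl fun i _ => by rw [Complex.mul_conj', Complex.ofReal_pow]

lemma cinner_conj_symm (u v : E2) : conj (cinner u v) = cinner v u := by
  simp [cinner, mul_comm]

@[simp]
lemma cinner_zero_left (v : E2) : cinner 0 v = 0 := by simp [cinner]

@[simp]
lemma cinner_zero_right (u : E2) : cinner u 0 = 0 := by simp [cinner]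

/-- The Taylor coefficients of the Blaschke factor `(ρ + e z) / (1 + ρ e z)`. -/
noncomputable def blaschkeCoeff (ρ : ℝ) (e : ℂ) : ℕ → ℂ
  | 0 => ρ
  | k + 1 => (1 - (ρ : ℂ) ^ 2) * e * (-ρ * e) ^ k

section BlaschkeCoeff

variable {ρ : ℝ} {e : ℂ}

lemma blaschkeCoeff_succ_mul_conj (he : e * conj e = 1) (m k : ℕ) :
    blaschkeCoeff ρ e (k + 1 + m) * conj (blaschkeCoeff ρ e (k + 1)) =
      (1 - (ρ : ℂ) ^ 2) ^ 2 * (-ρ * e) ^ m * ((ρ : ℂ) ^ 2) ^ k := by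
  have hpow : (-ρ * e) ^ k * (-ρ * conj e) ^ k = ((ρ : ℂ) ^ 2) ^ k := by
    rw [← mul_pow]
    congr 1
    linear_combination (ρ : ℂ) ^ 2 * he
  rw [show k + 1 + m = k + m + 1 by omega]
  simp only [blaschkeCoeff, map_mul, map_sub, map_pow, map_one, map_neg, Complex.conj_ofReal]
  rw [← hpow, pow_add]
  linear_combination (1 - (ρ : ℂ) ^ 2) ^ 2 * (-ρ * e) ^ m * (-ρ * e) ^ k *
    (-ρ * conj e) ^ k * he

/-- Partial sums of the autocorrelation of the Blaschke coefficients. -/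
lemma sum_range_blaschkeCoeff_mul_conj (he : e * conj e = 1) (m p : ℕ) :
    ∑ k ∈ Finset.range (p + 1), blaschkeCoeff ρ e (k + m) * conj (blaschkeCoeff ρ e k) =
      (if m = 0 then 1 else 0) - (1 - (ρ : ℂ) ^ 2) * (-ρ * e) ^ m * ((ρ : ℂ) ^ 2) ^ p := by
  induction p with
  | zero =>
    rcases m with _ | m
    · simp [blaschkeCoeff]
      ring
    · simp [blaschkeCoeff]
      ring
  | succ p ih =>
    rw [Finset.sum_range_succ, ih, blaschkeCoeff_succ_mul_conj he]
    ring

lemma hasSum_blaschkeCoeff_mul_conj (he : e * conj e = 1) (hρ : |ρ| < 1) (m : ℕ) :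
    HasSum (fun k => blaschkeCoeff ρ e (k + m) * conj (blaschkeCoeff ρ e k))
      (if m = 0 then 1 else 0) := by
  have hlt : ‖(ρ : ℂ) ^ 2‖ < 1 := by
    rw [norm_pow, Complex.norm_real, Real.norm_eq_abs]
    exact pow_lt_one₀ (abs_nonneg ρ) hρ two_ne_zero
  have hs : Summable (fun k => blaschkeCoeff ρ e (k + m) * conj (blaschkeCoeff ρ e k)) := by
    rw [← summable_nat_add_iff 1]
    simp only [blaschkeCoeff_succ_mul_conj he]
    exact (summable_geometric_of_norm_lt_one hlt).mul_left _
  have htend := (tendsto_pow_atTop_nhds_zero_of_norm_lt_one hlt).const_mul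
    ((1 - (ρ : ℂ) ^ 2) * (-ρ * e) ^ m)
  have hlim := htend.const_sub (if m = 0 then (1 : ℂ) else 0)
  simp only [← sum_range_blaschkeCoeff_mul_conj he, mul_zero, sub_zero] at hlim
  have hsum := hs.hasSum.tendsto_sum_nat.comp (Filter.tendsto_add_atTop_nat 1)
  exact tendsto_nhds_unique hsum hlim ▸ hs.hasSum

lemma blaschkeCoeff_mul_zero_mul_conj (he : e * conj e = 1) {p : ℕ} (hp : 0 < p) (m : ℕ) :
    blaschkeCoeff ρ e (p + m) * ρ * (ρ * conj (blaschkeCoeff ρ e p)) =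
      (1 - (ρ : ℂ) ^ 2) * ((1 - (ρ : ℂ) ^ 2) * (-ρ * e) ^ m * ((ρ : ℂ) ^ 2) ^ p) := by
  obtain ⟨k, rfl⟩ := Nat.exists_eq_add_one.2 hp
  linear_combination (ρ : ℂ) ^ 2 * blaschkeCoeff_succ_mul_conj (ρ := ρ) he m k

end BlaschkeCoeff

theorem stmt18 (u0 u1 : E2) (hu0 : ‖u0‖ = 1) (hu1 : ‖u1‖ = 1)
    (horth : cinner u0 u1 = 0)
    (ρ θ : ℝ) (hρ0 : 0 < ρ) (hρ1 : ρ < 1)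
    (a0 a1 : ℕ → E2)
    (ha00 : a0 0 = (ρ : ℂ) • u0)
    (ha0k : ∀ k : ℕ, 1 ≤ k → a0 k =
      (((1 - ρ ^ 2 : ℝ) : ℂ) * Complex.exp ((θ : ℂ) * Complex.I) *
        (-(ρ : ℂ) * Complex.exp ((θ : ℂ) * Complex.I)) ^ (k - 1)) • u0)
    (ha10 : a1 0 = u1)
    (ha1k : ∀ k : ℕ, 1 ≤ k → a1 k = 0) :
    condA a0 a1 ∧ condC a0 a1 := by
  have he : Complex.exp (θ * Complex.I) * conj (Complex.exp (θ * Complex.I)) = 1 := by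
    rw [Complex.mul_conj', Complex.norm_exp_ofReal_mul_I]
    simp
  set e := Complex.exp (θ * Complex.I)
  have ha0 : ∀ k, a0 k = blaschkeCoeff ρ e k • u0 := by
    rintro (_ | k)
    · exact ha00
    · rw [ha0k _ (by omega)]
      simp [blaschkeCoeff]
  have hself : cinner u0 u0 = 1 := by simp [cinner_self, hu0]
  have h00 : ∀ k l, cinner (a0 k) (a0 l) = blaschkeCoeff ρ e k * conj (blaschkeCoeff ρ e l) := by
    intro k l
    rw [ha0, ha0, cinner_smul_smul, hself, mul_one]
  have h01 : ∀ k l, cinner (a0 k) (a1 l) = 0 := by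
    rintro k (_ | l)
    · rw [ha0, ha10, ← one_smul ℂ u1, cinner_smul_smul, horth, mul_zero]
    · rw [ha1k _ (by omega), cinner_zero_right]
  have h10 : ∀ k l, cinner (a1 k) (a0 l) = 0 := fun k l => by
    rw [← cinner_conj_symm, h01, map_zero]
  have hd : ‖a0 0‖ ^ 2 = ρ ^ 2 := by
    rw [ha00, norm_smul, hu0, mul_one, Complex.norm_real, Real.norm_eq_abs, sq_abs]
  have h0 : blaschkeCoeff ρ e 0 = ρ := rfl
  refine ⟨⟨fun m => ?_, fun m => ?_, fun m => by simp [h01], fun m => by simp [h10]⟩,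
    fun p hp => ?_, fun p => ?_, fun p p' hp hpp' => ?_, fun p p' hpp' => ?_,
    fun p p' _ _ => by simp [h10], fun p p' _ => by simp [h10]⟩
  · simp only [h00]
    exact (hasSum_blaschkeCoeff_mul_conj he (abs_lt.2 ⟨by linarith, hρ1⟩) m).tsum_eq
  · rw [tsum_eq_single 0 fun k hk => by rw [ha1k k (by omega), cinner_zero_right]]
    rcases m with _ | m
    · simp [ha10, cinner_self, hu1]
    · simp [ha1k]
  · apply Complex.ofReal_injective
    have hsum := sum_range_blaschkeCoeff_mul_conj (ρ := ρ) he 0 p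
    simp only [add_zero, ← h00, cinner_self, if_true] at hsum
    rw [hd]
    push_cast
    rw [hsum, ← Complex.mul_conj', cinner_conj_symm, h00, h00, h0, Complex.conj_ofReal]
    linear_combination blaschkeCoeff_mul_zero_mul_conj (ρ := ρ) he hp 0
  · rw [h10, Finset.sum_range_succ']
    simp [ha1k, ha10, hu1]
  · obtain ⟨m, rfl⟩ := Nat.exists_eq_add_of_lt hpp'
    have hrefl : ∑ r ∈ Finset.range (p + 1), cinner (a0 (p + m + 1 - r)) (a0 (p - r)) =
        ∑ k ∈ Finset.range (p + 1), cinner (a0 (k + (m + 1))) (a0 k) := by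
      rw [← Finset.sum_range_reflect]
      refine Finset.sum_congr rfl fun r hr => ?_
      have := Finset.mem_range.1 hr
      congr 2 <;> omega
    rw [hrefl, hd]
    simp only [h00]
    rw [sum_range_blaschkeCoeff_mul_conj he, if_neg (Nat.succ_ne_zero m), h0,
      Complex.conj_ofReal]
    push_cast
    linear_combination blaschkeCoeff_mul_zero_mul_conj (ρ := ρ) he hp (m + 1)
  · rw [h10, zero_mul, Finset.sum_eq_zero, mul_zero]
    intro r hr
    have := Finset.mem_range.1 hr
    rw [ha1k _ (by omega), cinner_zero_left]
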